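/- arXiv:2108.13537 — 3 statements merged into one kernel-verified Lean document; each statement's English description precedes it below -/
import Mathlib

section
/- Let K be a field, n ≥ 2, and H an n×n matrix over K (rows and columns indexed 1,…,n) that is lower Hessenberg: H_{i,j} = 0 whenever j > i+1. Set α_i = H_{i,i+1} for i = 1,…,n−1 and assume all α_i ≠ 0 and that H is nonsingular. Let P be the (n−1)×(n−1) matrix with P_{a,b} = H_{a,b+1} for 1 ≤ a, b ≤ n−1 (H with its last row and first column deleted); P is lower triangular with nonzero diagonal α_1,…,α_{n−1}, hence invertible. Define x_1,…,x_n ∈ K by x_1 = 1 and x_i = −(∑_{j=1}^{i−1} H_{i−1,j}·x_j)/α_{i−1} for i = 2,…,n; then ∑_{j=1}^{n} H_{n,j}·x_j ≠ 0, and define w_1,…,w_n ∈ K by w_n = 1/(∑_{j=1}^{n} H_{n,j}·x_j) and w_i = −(∑_{j=i+1}^{n} H_{j,i+1}·w_j)/α_i for i = n−1,…,1. Then H^{-1} = B + x·wᵀ, where x·wᵀ is the rank-one matrix with (i,j)-entry x_i·w_j and B is the n×n matrix whose (i,j)-entry equals (P^{-1})_{i−1,j} when 2 ≤ i ≤ n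 and 1 ≤ j ≤ n−1, and 0 otherwise. -/
open Finset

/-- If all rows of `H` but the last annihilate `x` and all columns but the first annihilate `w`,
then, after normalisation, `H` is inverted by the zero-bordered inverse of its upper right block
plus the rank-one matrix `x wᵀ`. -/
theorem bordered_inverse_add_vecMulVec_mul {K : Type*} [Field K] {m : ℕ}
    (H : Matrix (Fin (m + 1)) (Fin (m + 1)) K)
    (hP : IsUnit (H.submatrix Fin.castSucc Fin.succ).det) (x w : Fin (m + 1) → K)
    (hx0 : x 0 = 1) (hx : ∀ i : Fin m, ∑ j, H i.castSucc j * x j = 0)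
    (hw : ∀ j : Fin m, ∑ k, w k * H k j.succ = 0)
    (hwx : w (Fin.last m) * ∑ j, H (Fin.last m) j * x j = 1)
    (M : Matrix (Fin (m + 1)) (Fin (m + 1)) K)
    (hM0 : ∀ j, M 0 j = x 0 * w j)
    (hMl : ∀ i, M i (Fin.last m) = x i * w (Fin.last m))
    (hM : ∀ i j : Fin m, M i.succ j.castSucc =
      (H.submatrix Fin.castSucc Fin.succ)⁻¹ i j + x i.succ * w j.castSucc) :
    M * H = 1 := by
  have hcol : ∀ (i : Fin (m + 1)) (j : Fin m),
      (M * H) i j.succ = (1 : Matrix (Fin (m + 1)) (Fin (m + 1)) K) i j.succ := by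
    intro i j
    rw [Matrix.mul_apply]
    have hwj := hw j
    refine Fin.cases ?_ (fun a => ?_) i
    · simp only [hM0, mul_assoc, ← mul_sum, hwj, mul_zero]
      exact (Matrix.one_apply_ne (Fin.succ_ne_zero j).symm).symm
    · have hPP := congrFun₂ (Matrix.nonsing_inv_mul _ hP) a j
      rw [Matrix.mul_apply] at hPP
      simp only [Matrix.submatrix_apply] at hPP
      rw [Fin.sum_univ_castSucc] at hwj ⊢
      simp only [hM, hMl, add_mul, sum_add_distrib, mul_assoc, ← mul_sum, hPP]
      rw [add_assoc, ← mul_add, hwj, mul_zero, add_zero]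
      simp [Matrix.one_apply]
  have hHx : Matrix.mulVec H x =
      Pi.single (Fin.last m) (∑ j, H (Fin.last m) j * x j) := by
    ext i
    refine Fin.lastCases ?_ (fun a => ?_) i
    · simp [Matrix.mulVec, dotProduct]
    · rw [Pi.single_eq_of_ne (Fin.castSucc_lt_last a).ne]
      exact hx a
  have hMHx : Matrix.mulVec (M * H) x = x := by
    ext i
    rw [← Matrix.mulVec_mulVec, hHx, Matrix.mulVec_single]
    simp [hMl, mul_assoc, hwx]
  ext i j
  refine Fin.cases ?_ (fun b => hcol i b) j
  have h : Matrix.mulVec (M * H) x i = Matrix.mulVec 1 x i := by rw [hMHx, Matrix.one_mulVec]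
  simp only [Matrix.mulVec, dotProduct] at h
  rw [Fin.sum_univ_succ, Fin.sum_univ_succ] at h
  simpa [hcol, hx0] using h

/-- Ikebe–Zhong characterization of the inverse of a nonsingular lower Hessenberg
matrix `H` of order `n ≥ 2` with nonzero superdiagonal entries:
`H⁻¹ = B + x·wᵀ`, where `B` is built from the inverse of the triangular submatrix
`P` of `H` (delete last row and first column), and the vectors `x`, `w` are
defined by the stated recurrences (indices here are `0,…,n-1`, corresponding to
the paper's `1,…,n`). -/
theorem hessenberg_inverse_ikebe_zhong
    (K : Type*) [Field K] (n : ℕ) (hn : 2 ≤ n)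
    (H : Matrix (Fin n) (Fin n) K)
    (hHess : ∀ i j : Fin n, (i : ℕ) + 1 < (j : ℕ) → H i j = 0)
    (hα : ∀ i : Fin n, ∀ h : (i : ℕ) + 1 < n, H i ⟨(i : ℕ) + 1, h⟩ ≠ 0)
    (hdet : IsUnit H.det)
    (P : Matrix (Fin (n - 1)) (Fin (n - 1)) K)
    (hP : ∀ a b : Fin (n - 1),
      P a b = H ⟨(a : ℕ), lt_of_lt_of_le a.isLt (Nat.sub_le n 1)⟩
        ⟨(b : ℕ) + 1, by have := b.isLt; omega⟩)
    (x : Fin n → K)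
    (hx0 : x ⟨0, by omega⟩ = 1)
    (hx : ∀ i : Fin n, 0 < (i : ℕ) →
      x i = -(∑ j ∈ univ.filter (fun j : Fin n => (j : ℕ) < (i : ℕ)),
          H ⟨(i : ℕ) - 1, lt_of_le_of_lt (Nat.sub_le _ _) i.isLt⟩ j * x j)
        / H ⟨(i : ℕ) - 1, lt_of_le_of_lt (Nat.sub_le _ _) i.isLt⟩ i)
    (w : Fin n → K)
    (hwn : w ⟨n - 1, by omega⟩ = (∑ j : Fin n, H ⟨n - 1, by omega⟩ j * x j)⁻¹)
    (hw : ∀ i : Fin n, ∀ h : (i : ℕ) < n - 1,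
      w i = -(∑ j ∈ univ.filter (fun j : Fin n => (i : ℕ) < (j : ℕ)),
          H j ⟨(i : ℕ) + 1, by omega⟩ * w j)
        / H i ⟨(i : ℕ) + 1, by omega⟩) :
    (∑ j : Fin n, H ⟨n - 1, by omega⟩ j * x j) ≠ 0 ∧
    H⁻¹ = Matrix.of (fun i j : Fin n =>
      (if h : 1 ≤ (i : ℕ) ∧ (j : ℕ) < n - 1 then
        P⁻¹ ⟨(i : ℕ) - 1, by have := i.isLt; omega⟩ ⟨(j : ℕ), h.2⟩
      else 0) + x i * w j) := by
  obtain ⟨m, rfl⟩ : ∃ m, n = m + 1 := ⟨n - 1, by omega⟩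
  have hPH : P = H.submatrix Fin.castSucc Fin.succ := by
    ext a b
    exact hP a b
  have hPdet : IsUnit (H.submatrix Fin.castSucc Fin.succ).det := by
    rw [Matrix.det_of_isLowerTriangular]
    · rw [isUnit_iff_ne_zero, prod_ne_zero_iff]
      intro i _
      exact hα i.castSucc (by simp)
    · intro i j hij
      have hij' : (i : ℕ) < j := hij
      exact hHess _ _ (by simpa using hij')
  have hrow : ∀ i : Fin m, ∑ j, H i.castSucc j * x j = 0 := by
    intro i
    have h := hx i.succ (by simp)
    have hne : H i.castSucc i.succ ≠ 0 := hα i.castSucc (by simp)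
    change x i.succ = -(∑ j ∈ univ.filter (fun j : Fin (m + 1) => (j : ℕ) < (i.succ : ℕ)),
      H i.castSucc j * x j) / H i.castSucc i.succ at h
    rw [eq_div_iff hne] at h
    rw [← sum_filter_add_sum_filter_not univ
      (fun j : Fin (m + 1) => (j : ℕ) < (i.succ : ℕ)),
      sum_eq_single_of_mem (s := univ.filter fun j : Fin (m + 1) => ¬ (j : ℕ) < (i.succ : ℕ))
        i.succ (by simp)]
    · linear_combination h
    · intro j hj hji
      have hj' : ¬ (j : ℕ) < (i.succ : ℕ) := (mem_filter.mp hj).2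
      have : (j : ℕ) ≠ i.succ := Fin.val_ne_of_ne hji
      rw [hHess _ _ (by simp at *; omega), zero_mul]
  have hcol : ∀ j : Fin m, ∑ k, w k * H k j.succ = 0 := by
    intro j
    have h := hw j.castSucc (by simp)
    have hne : H j.castSucc j.succ ≠ 0 := hα j.castSucc (by simp)
    change w j.castSucc = -(∑ k ∈ univ.filter
      (fun k : Fin (m + 1) => (j.castSucc : ℕ) < (k : ℕ)), H k j.succ * w k) /
        H j.castSucc j.succ at h
    rw [eq_div_iff hne] at h
    simp only [mul_comm (w _)] at h ⊢
    rw [← sum_filter_add_sum_filter_not univ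
      (fun k : Fin (m + 1) => (j.castSucc : ℕ) < (k : ℕ)),
      sum_eq_single_of_mem (s := univ.filter fun k : Fin (m + 1) => ¬ (j.castSucc : ℕ) < (k : ℕ))
        j.castSucc (by simp)]
    · linear_combination h
    · intro k hk hkj
      have hk' : ¬ (j.castSucc : ℕ) < (k : ℕ) := (mem_filter.mp hk).2
      have : (k : ℕ) ≠ j.castSucc := Fin.val_ne_of_ne hkj
      rw [hHess _ _ (by simp at *; omega), zero_mul]
  have hs : (∑ j, H (Fin.last m) j * x j) ≠ 0 := by
    intro hs
    have hHx : Matrix.mulVec H x = 0 := by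
      ext i
      exact Fin.lastCases hs hrow i
    have hx_zero := Matrix.eq_zero_of_mulVec_eq_zero hdet.ne_zero hHx
    exact one_ne_zero (hx0.symm.trans (congrFun hx_zero _))
  refine ⟨hs, Matrix.inv_eq_left_inv ?_⟩
  subst hPH
  refine bordered_inverse_add_vecMulVec_mul H hPdet x w hx0 hrow hcol ?_ _ ?_ ?_ ?_
  · exact (congrArg (· * _) hwn).trans (inv_mul_cancel₀ hs)
  · intro j
    simp
  · intro i
    simp
  · intro i j
    simp
end

section
/- Let K be a field, n ≥ 2, and H an n×n lower Hessenberg matrix over K (H_{i,j} = 0 for j > i+1, indices 1,…,n) with superdiagonal entries α_i = H_{i,i+1} ≠ 0 for i = 1,…,n−1. Define x_1,…,x_n ∈ K by x_1 = 1 and x_i = −(∑_{j=1}^{i−1} H_{i−1,j}·x_j)/α_{i−1} for i = 2,…,n. Then (∑_{j=1}^{n} H_{n,j}·x_j) · ∏_{i=1}^{n−1} α_i = (−1)^{n−1} · det(H). -/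
open Finset

/-- If `H *ᵥ x` is supported on the last coordinate and `x 0 = 1`, then the last coordinate of
`H *ᵥ x` times the minor of `H` without its last row and first column is, up to sign, `det H`. -/
theorem mulVec_last_mul_det_submatrix {R : Type*} [CommRing R] {m : ℕ}
    (H : Matrix (Fin (m + 1)) (Fin (m + 1)) R) (x : Fin (m + 1) → R) (hx0 : x 0 = 1)
    (hx : ∀ i : Fin m, H.mulVec x i.castSucc = 0) :
    H.mulVec x (Fin.last m) * (H.submatrix Fin.castSucc Fin.succ).det = (-1) ^ m * H.det := by
  have key : H.adjugate.mulVec (H.mulVec x) 0 = H.det := by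
    rw [Matrix.mulVec_mulVec, Matrix.adjugate_mul, Matrix.smul_mulVec, Matrix.one_mulVec]
    simp [hx0]
  rw [Matrix.mulVec, dotProduct, Fin.sum_univ_castSucc] at key
  simp only [hx, mul_zero, sum_const_zero, zero_add,
    Matrix.adjugate_fin_succ_eq_det_submatrix, Fin.succAbove_last, Fin.val_last,
    Fin.val_zero, add_zero] at key
  rw [Fin.succAbove_zero] at key
  rw [← key, ← mul_assoc, ← mul_assoc, ← mul_pow]
  simp [mul_comm]

/-- Deleting the last row and the first column of a lower Hessenberg matrix leaves a lower
triangular matrix, whose determinant is the product of the superdiagonal entries. -/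
theorem det_submatrix_castSucc_succ_of_hessenberg {R : Type*} [CommRing R] {m : ℕ}
    (H : Matrix (Fin (m + 1)) (Fin (m + 1)) R)
    (hHess : ∀ i j : Fin (m + 1), (i : ℕ) + 1 < (j : ℕ) → H i j = 0) :
    (H.submatrix Fin.castSucc Fin.succ).det = ∏ i : Fin m, H i.castSucc i.succ := by
  rw [Matrix.det_of_isLowerTriangular]
  · rfl
  · intro i j hij
    apply hHess
    have : (i : ℕ) < j := hij
    simpa using this

/-- For a lower Hessenberg matrix `H` of order `n ≥ 2` with nonzero superdiagonal
entries `α_i`, the vector `x` defined by the stated recurrence satisfies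
`(∑_j H_{n,j} x_j) · ∏ α_i = (-1)^{n-1} · det H` (indices here are `0,…,n-1`,
corresponding to the paper's `1,…,n`). -/
theorem hessenberg_det_formula
    (K : Type*) [Field K] (n : ℕ) (hn : 2 ≤ n)
    (H : Matrix (Fin n) (Fin n) K)
    (hHess : ∀ i j : Fin n, (i : ℕ) + 1 < (j : ℕ) → H i j = 0)
    (hα : ∀ i : Fin n, ∀ h : (i : ℕ) + 1 < n, H i ⟨(i : ℕ) + 1, h⟩ ≠ 0)
    (x : Fin n → K)
    (hx0 : x ⟨0, by omega⟩ = 1)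
    (hx : ∀ i : Fin n, 0 < (i : ℕ) →
      x i = -(∑ j ∈ univ.filter (fun j : Fin n => (j : ℕ) < (i : ℕ)),
          H ⟨(i : ℕ) - 1, lt_of_le_of_lt (Nat.sub_le _ _) i.isLt⟩ j * x j)
        / H ⟨(i : ℕ) - 1, lt_of_le_of_lt (Nat.sub_le _ _) i.isLt⟩ i) :
    (∑ j : Fin n, H ⟨n - 1, by omega⟩ j * x j) *
      (∏ i : Fin (n - 1),
        H ⟨(i : ℕ), lt_of_lt_of_le i.isLt (Nat.sub_le n 1)⟩
          ⟨(i : ℕ) + 1, by have := i.isLt; omega⟩)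
      = (-1) ^ (n - 1) * H.det := by
  obtain ⟨m, rfl⟩ : ∃ m, n = m + 1 := ⟨n - 1, by omega⟩
  have hzero : ∀ i : Fin m, H.mulVec x i.castSucc = 0 := by
    intro i
    have hα' : H i.castSucc i.succ ≠ 0 := hα i.castSucc (by simp)
    have hxi : x i.succ = -(∑ j ∈ univ.filter (fun j : Fin (m + 1) => (j : ℕ) < (i.succ : ℕ)),
        H i.castSucc j * x j) / H i.castSucc i.succ := hx i.succ (by simp)
    rw [eq_div_iff hα'] at hxi
    have hrest : ∑ j ∈ univ.filter (fun j : Fin (m + 1) => ¬ (j : ℕ) < (i.succ : ℕ)),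
        H i.castSucc j * x j = H i.castSucc i.succ * x i.succ := by
      refine sum_eq_single_of_mem _ (by simp) fun j hj hne => ?_
      have hj' : ¬ (j : ℕ) < (i.succ : ℕ) := (mem_filter.mp hj).2
      have hne' : (j : ℕ) ≠ (i.succ : ℕ) := fun h => hne (Fin.ext h)
      rw [hHess i.castSucc j (by simp at hj' hne' ⊢; omega), zero_mul]
    rw [Matrix.mulVec, dotProduct,
      ← sum_filter_add_sum_filter_not univ (fun j : Fin (m + 1) => (j : ℕ) < (i.succ : ℕ)),
      hrest, mul_comm, hxi, add_neg_cancel]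
  have h := mulVec_last_mul_det_submatrix H x hx0 hzero
  rw [det_submatrix_castSucc_succ_of_hessenberg H hHess] at h
  exact h
end

section
/- Let E be the integer matrix with E(j,0) = j+1 and, for k ≥ 1, E(j,k) = C(j,k+1) − C(j,k), where C(j,k) is the binomial coefficient (E is the inverse of the almost Riordan array A = ((1+2x)/(1−x²); 1/((x−1)(1+x)²), x/(1+x))). Then the diagonal sums of E are F_n + 1: for all n ≥ 0, ∑_{k=0}^{n} E(n−k, k) = F_n + 1, where F_n is the n-th Fibonacci number (F_0 = 0, F_1 = 1, F_{n+2} = F_{n+1} + F_n). -/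
open Finset

/-- The Fibonacci numbers are the diagonal sums of Pascal's triangle. -/
theorem sum_range_choose_sub_eq_fib (n : ℕ) :
    ∑ k ∈ range (n + 1), (n - k).choose k = Nat.fib (n + 1) := by
  rw [Nat.fib_succ_eq_sum_choose, ← Finset.Nat.sum_antidiagonal_swap,
    Finset.Nat.sum_antidiagonal_eq_sum_range_succ_mk]
  rfl

theorem sum_range_choose_sub_succ_add_one (n : ℕ) :
    ∑ k ∈ range (n + 1), (n - k).choose (k + 1) + 1 = Nat.fib (n + 2) := by
  rw [← sum_range_choose_sub_eq_fib (n + 1), sum_range_succ' _ (n + 1)]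
  simp

/-- The diagonal sums of the matrix `E` (the inverse of the almost Riordan array
`((1+2x)/(1-x²); 1/((x-1)(1+x)²), x/(1+x))`), given by `E(j,0) = j+1` and
`E(j,k) = C(j,k+1) - C(j,k)` for `k ≥ 1`, are `F_n + 1`. -/
theorem diagonal_sums_inverse_fib
    (E : ℕ → ℕ → ℤ)
    (hE0 : ∀ j, E j 0 = (j : ℤ) + 1)
    (hEk : ∀ j k, 1 ≤ k → E j k = (j.choose (k + 1) : ℤ) - (j.choose k : ℤ)) :
    ∀ n : ℕ, (∑ k ∈ range (n + 1), E (n - k) k) = (Nat.fib n : ℤ) + 1 := by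
  intro n
  have h₁ : (∑ k ∈ range (n + 1), ((n - k).choose k : ℤ)) = Nat.fib (n + 1) := by
    exact_mod_cast sum_range_choose_sub_eq_fib n
  have h₂ : (∑ k ∈ range (n + 1), ((n - k).choose (k + 1) : ℤ)) + 1 = Nat.fib (n + 2) := by
    exact_mod_cast sum_range_choose_sub_succ_add_one n
  have hE : ∑ k ∈ range (n + 1), E (n - k) k =
      ∑ k ∈ range (n + 1), (((n - k).choose (k + 1) : ℤ) - ((n - k).choose k : ℤ)) + 2 := by
    rw [sum_range_succ', sum_range_succ',
      sum_congr rfl fun k _ => hEk (n - (k + 1)) (k + 1) k.succ_pos, hE0]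
    simp
    ring
  rw [hE, sum_sub_distrib]
  have h₃ : (Nat.fib (n + 2) : ℤ) = Nat.fib n + Nat.fib (n + 1) := by
    exact_mod_cast Nat.fib_add_two
  linarith
end
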